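/- For any K-vector space Y, regarded as a representation of U with trivial U-action, the natural map Y → Hom_U(W, Y ⊗_K W), sending y to the map w ↦ y ⊗ w, is a K-linear isomorphism onto the space of U-equivariant K-linear maps from W to Y ⊗_K W (where U acts diagonally on Y ⊗_K W, i.e. trivially on Y and through ρ on W). -/

import Mathlib

open TensorProduct

/-- Over a field, the maps `Y ⊗ W → W` induced by linear functionals on `Y` separate points. -/
theorem TensorProduct.eq_of_forall_lid_rTensor {K Y W : Type*} [Field K]
    [AddCommGroup Y] [Module K Y] [AddCommGroup W] [Module K W] {s t : Y ⊗[K] W}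
    (h : ∀ l : Y →ₗ[K] K,
      TensorProduct.lid K W (l.rTensor W s) = TensorProduct.lid K W (l.rTensor W t)) :
    s = t := by
  classical
  let b := Module.Basis.ofVectorSpace K Y
  apply (TensorProduct.equivFinsuppOfBasisLeft (N := W) b).injective
  ext i
  simpa only [TensorProduct.equivFinsuppOfBasisLeft_apply] using h (b.coord i)

/-- Let `K` be a field, `U` a group, and `(ρ, W)` a nonzero finite-dimensional
`K`-representation of `U` with `End_U(W) = K` (every `U`-equivariant endomorphism of `W` is a
scalar).  For any `K`-vector space `Y` with trivial `U`-action, the natural map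
`Y → Hom_U(W, Y ⊗ W)`, `y ↦ (w ↦ y ⊗ w)`, is a `K`-linear isomorphism onto the space of
`U`-equivariant `K`-linear maps `W → Y ⊗ W` (with `U` acting diagonally on `Y ⊗ W`, i.e.
trivially on `Y` and through `ρ` on `W`). -/
theorem stmt4
    (K : Type*) [Field K] (U : Type*) [Group U]
    (W : Type*) [AddCommGroup W] [Module K W] [FiniteDimensional K W] [Nontrivial W]
    (ρ : U →* (W ≃ₗ[K] W))
    (hschur : ∀ φ : W →ₗ[K] W,
      (∀ u : U, φ ∘ₗ (ρ u).toLinearMap = (ρ u).toLinearMap ∘ₗ φ) →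
      ∃ c : K, φ = c • LinearMap.id)
    (Y : Type*) [AddCommGroup Y] [Module K Y] :
    Function.Injective (TensorProduct.mk K Y W) ∧
    ∀ f : W →ₗ[K] Y ⊗[K] W,
      (∃ y : Y, TensorProduct.mk K Y W y = f) ↔
      ∀ u : U, f ∘ₗ (ρ u).toLinearMap = LinearMap.lTensor Y (ρ u).toLinearMap ∘ₗ f := by
  obtain ⟨w₀, hw₀⟩ := exists_ne (0 : W)
  obtain ⟨η, hη⟩ := Module.Projective.exists_dual_eq_one K hw₀
  refine ⟨fun y y' h => ?_, fun f => ⟨?_, fun hf => ?_⟩⟩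
  · have h' := congrArg (fun g : W →ₗ[K] Y ⊗[K] W =>
      TensorProduct.rid K Y (η.lTensor Y (g w₀))) h
    simpa [hη] using h'
  · rintro ⟨y, rfl⟩ u
    ext w
    simp
  · refine ⟨TensorProduct.rid K Y (η.lTensor Y (f w₀)), ?_⟩
    ext w
    apply TensorProduct.eq_of_forall_lid_rTensor
    intro l
    have hcomm : ∀ (g : W →ₗ[K] W) (t : Y ⊗[K] W),
        TensorProduct.lid K W (l.rTensor W (g.lTensor Y t)) =
          g (TensorProduct.lid K W (l.rTensor W t)) := by
      intro g t
      induction t with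
      | zero => simp
      | tmul y w => simp
      | add s t hs ht => simp only [map_add, hs, ht]
    have hcontract : ∀ t : Y ⊗[K] W, l (TensorProduct.rid K Y (η.lTensor Y t)) =
        η (TensorProduct.lid K W (l.rTensor W t)) := by
      intro t
      induction t with
      | zero => simp
      | tmul y w => simp [mul_comm]
      | add s t hs ht => simp only [map_add, hs, ht]
    obtain ⟨c, hc⟩ := hschur ((TensorProduct.lid K W).toLinearMap ∘ₗ l.rTensor W ∘ₗ f) (by
      intro u
      ext v
      have h := LinearMap.congr_fun (hf u) v
      simp only [LinearMap.comp_apply, LinearEquiv.coe_coe] at h ⊢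
      rw [h, hcomm]
      rfl)
    have hscalar : ∀ v, TensorProduct.lid K W (l.rTensor W (f v)) = c • v :=
      fun v => LinearMap.congr_fun hc v
    simp [hscalar, hcontract, hη]
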